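/- arXiv:1606.08731 — 4 statements merged into one kernel-verified Lean document; each statement's English description precedes it below -/
import Mathlib

section
/- Let (Ω, F, P) be a probability space, f : [0,∞) → ℝ a bounded measurable function, (Y_i)_{i≥1} a sequence of random variables with Y_i ≤ 0 almost surely, and (τ_i)_{i≥1} a nondecreasing sequence of random variables with values in [0,∞]. Then liminf_{T→∞} (1/T) ( ∫_0^T f(s) ds + E[ Σ_{i=1}^∞ 1_{τ_i ≤ T} Y_i ] ) ≤ liminf_{α→0+} α ( ∫_0^∞ e^{−αs} f(s) ds + E[ Σ_{i=1}^∞ 1_{τ_i < ∞} e^{−ατ_i} Y_i ] ), where the inequality is understood in the extended real numbers. -/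
open MeasureTheory Filter Set
open scoped ENNReal Topology

theorem setLIntegral_Ioi_ofReal_mul_exp {α : ℝ} (hα : 0 < α) (c : ℝ) :
    ∫⁻ x in Ioi c, ENNReal.ofReal (α * Real.exp (-α * x)) =
      ENNReal.ofReal (Real.exp (-α * c)) := by
  have hneg : -α < 0 := neg_lt_zero.mpr hα
  rw [← ofReal_integral_eq_lintegral_ofReal ((integrableOn_exp_mul_Ioi hneg c).const_mul α)
    (ae_of_all _ fun x => by positivity), integral_const_mul, integral_exp_mul_Ioi hneg]
  congr 1
  field_simp

/-- The weight `e^{-αt}`, extended by `0` at `t = ∞`, as a mixture of the indicators `1_{t ≤ T}`. -/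
theorem setLIntegral_Ioi_ofReal_mul_exp_indicator {α : ℝ} (hα : 0 < α) (t : ℝ≥0∞) :
    ∫⁻ T in Ioi (0 : ℝ), ENNReal.ofReal (α * Real.exp (-α * T)) *
        (if t ≤ ENNReal.ofReal T then 1 else 0) =
      if t < ⊤ then ENNReal.ofReal (Real.exp (-α * t.toReal)) else 0 := by
  rcases eq_or_ne t ⊤ with rfl | ht
  · simp
  · rw [if_pos ht.lt_top, ← setLIntegral_Ioi_ofReal_mul_exp hα,
      setLIntegral_congr (Ioi_ae_eq_Ici (a := t.toReal)),
      ← lintegral_indicator measurableSet_Ioi, ← lintegral_indicator measurableSet_Ici]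
    refine lintegral_congr_ae ?_
    filter_upwards [measure_eq_zero_iff_ae_notMem.mp (measure_singleton (μ := volume) (0 : ℝ))]
      with T hT
    have hT0 : T ≠ 0 := hT
    have h0 : 0 ≤ t.toReal := ENNReal.toReal_nonneg
    by_cases hT' : 0 < T
    · have : t ≤ ENNReal.ofReal T ↔ t.toReal ≤ T := ENNReal.le_ofReal_iff_toReal_le ht hT'.le
      by_cases h : t.toReal ≤ T <;> simp [indicator, hT', this, h]
    · have : ¬ t.toReal ≤ T := fun h => hT' (lt_of_le_of_ne (h0.trans h) hT0.symm)
      simp [indicator, hT', this]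

theorem lintegral_exp_weight_eq {X : Type*} [MeasurableSpace X] (ν : Measure X) [SFinite ν]
    {α : ℝ} (hα : 0 < α) {t w : X → ℝ≥0∞} (ht : Measurable t) (hw : Measurable w) :
    ∫⁻ x, (if t x < ⊤ then ENNReal.ofReal (Real.exp (-α * (t x).toReal)) else 0) * w x ∂ν =
      ∫⁻ T in Ioi (0 : ℝ), ENNReal.ofReal (α * Real.exp (-α * T)) *
        ∫⁻ x, (if t x ≤ ENNReal.ofReal T then w x else 0) ∂ν := by
  have hm : Measurable fun p : X × ℝ => if t p.1 ≤ ENNReal.ofReal p.2 then (1 : ℝ≥0∞) else 0 :=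
    Measurable.ite (measurableSet_le (by fun_prop) (by fun_prop)) measurable_const measurable_const
  have hg : Measurable fun T : ℝ => ENNReal.ofReal (α * Real.exp (-α * T)) := by fun_prop
  calc
    _ = ∫⁻ x, (∫⁻ T in Ioi (0 : ℝ), ENNReal.ofReal (α * Real.exp (-α * T)) *
          (if t x ≤ ENNReal.ofReal T then 1 else 0) * w x) ∂ν := by
        refine lintegral_congr fun x => ?_
        rw [← setLIntegral_Ioi_ofReal_mul_exp_indicator hα, lintegral_mul_const]
        exact hg.mul (hm.comp measurable_prodMk_left)
    _ = ∫⁻ T in Ioi (0 : ℝ), (∫⁻ x, ENNReal.ofReal (α * Real.exp (-α * T)) *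
          (if t x ≤ ENNReal.ofReal T then 1 else 0) * w x ∂ν) :=
        lintegral_lintegral_swap
          (((hg.comp measurable_snd).mul hm).mul (hw.comp measurable_fst)).aemeasurable
    _ = _ := by
        refine lintegral_congr fun T => ?_
        rw [← lintegral_const_mul' _ _ ENNReal.ofReal_ne_top]
        refine lintegral_congr fun x => ?_
        split_ifs <;> simp

theorem setLIntegral_Ioi_ofReal_mul_exp_mul_id {α : ℝ} (hα : 0 < α) :
    ∫⁻ T in Ioi (0 : ℝ), ENNReal.ofReal (α * Real.exp (-α * T)) * ENNReal.ofReal T =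
      ENNReal.ofReal (1 / α) := by
  have h := lintegral_exp_weight_eq (volume.restrict (Ioi (0 : ℝ))) hα
    (t := ENNReal.ofReal) (w := fun _ => 1) ENNReal.measurable_ofReal measurable_const
  have hl : ∀ T ∈ Ioi (0 : ℝ), ∫⁻ x in Ioi (0 : ℝ),
      (if ENNReal.ofReal x ≤ ENNReal.ofReal T then (1 : ℝ≥0∞) else 0) = ENNReal.ofReal T := by
    intro T hT
    have : ∀ x : ℝ, (if ENNReal.ofReal x ≤ ENNReal.ofReal T then (1 : ℝ≥0∞) else 0) =
        (Iic T).indicator 1 x := fun x => by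
      simp [indicator, ENNReal.ofReal_le_ofReal_iff (le_of_lt hT)]
    simp_rw [this]
    rw [lintegral_indicator_one measurableSet_Iic, Measure.restrict_apply measurableSet_Iic,
      Iic_inter_Ioi, Real.volume_Ioc, sub_zero]
  refine (setLIntegral_congr_fun measurableSet_Ioi fun T hT => ?_).trans (h.symm.trans ?_)
  · simp only [hl T hT]
  have h2 : ∫⁻ x in Ioi (0 : ℝ), (if ENNReal.ofReal x < ⊤ then
      ENNReal.ofReal (Real.exp (-α * (ENNReal.ofReal x).toReal)) else 0) * 1 =
      ∫⁻ x in Ioi (0 : ℝ), ENNReal.ofReal (Real.exp (-α * x)) :=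
    setLIntegral_congr_fun measurableSet_Ioi fun x hx => by
      simp [ENNReal.toReal_ofReal (le_of_lt hx)]
  rw [h2, ← ofReal_integral_eq_lintegral_ofReal
    (integrableOn_exp_mul_Ioi (neg_lt_zero.mpr hα) 0) (ae_of_all _ fun x => by positivity),
    integral_exp_mul_Ioi (neg_lt_zero.mpr hα)]
  congr 1
  simp

/-- Abelian bound: linear growth of a monotone `N` controls its exponential averages. -/
theorem setLIntegral_exp_mul_le_of_linear_growth {N : ℝ → ℝ≥0∞} (hN : Monotone N) {L T₀ : ℝ}
    (hL : 0 ≤ L) (h : ∀ T, T₀ ≤ T → N T ≤ ENNReal.ofReal (L * T)) {α : ℝ} (hα : 0 < α) :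
    ∫⁻ T in Ioi (0 : ℝ), ENNReal.ofReal (α * Real.exp (-α * T)) * N T ≤
      N T₀ + ENNReal.ofReal (L / α) := by
  have hg : Measurable fun T : ℝ => ENNReal.ofReal (α * Real.exp (-α * T)) := by fun_prop
  calc
    _ ≤ ∫⁻ T in Ioi (0 : ℝ), (ENNReal.ofReal (α * Real.exp (-α * T)) * N T₀ +
          ENNReal.ofReal L * (ENNReal.ofReal (α * Real.exp (-α * T)) * ENNReal.ofReal T)) := by
        refine lintegral_mono fun T => ?_
        have hT : N T ≤ N T₀ + ENNReal.ofReal L * ENNReal.ofReal T := by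
          rcases le_total T T₀ with hT | hT
          · exact (hN hT).trans le_self_add
          · rw [← ENNReal.ofReal_mul hL]
            exact (h T hT).trans le_add_self
        calc _ ≤ ENNReal.ofReal (α * Real.exp (-α * T)) *
              (N T₀ + ENNReal.ofReal L * ENNReal.ofReal T) := by gcongr
          _ = _ := by ring
    _ = _ := by
        rw [lintegral_add_left (hg.mul_const _), lintegral_mul_const _ hg,
          setLIntegral_Ioi_ofReal_mul_exp hα,
          lintegral_const_mul' _ _ ENNReal.ofReal_ne_top,
          setLIntegral_Ioi_ofReal_mul_exp_mul_id hα, ← ENNReal.ofReal_mul hL]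
        simp [div_eq_mul_inv]

theorem setLIntegral_Ioi_ofReal_sub_indicator {f : ℝ → ℝ} (hf : Measurable f) {C : ℝ}
    (hC : ∀ s, |f s| ≤ C) {T : ℝ} (hT : 0 ≤ T) :
    ∫⁻ s in Ioi (0 : ℝ), (if ENNReal.ofReal s ≤ ENNReal.ofReal T
        then ENNReal.ofReal (C - f s) else 0) =
      ENNReal.ofReal (C * T - ∫ s in Ioc 0 T, f s) := by
  have hif : IntegrableOn f (Ioc 0 T) :=
    Measure.integrableOn_of_bounded (by simp) hf.aestronglyMeasurable
      (ae_of_all _ fun s => by simpa using hC s)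
  have hic : IntegrableOn (fun _ => C) (Ioc 0 T) := integrableOn_const (by simp)
  have hi : ∫ s in Ioc 0 T, (C - f s) = C * T - ∫ s in Ioc 0 T, f s := by
    rw [integral_sub hic hif]
    simp [hT, mul_comm]
  rw [← hi, ofReal_integral_eq_lintegral_ofReal (f := fun s => C - f s) (hic.sub hif)
    (ae_of_all _ fun s => sub_nonneg.mpr ((le_abs_self _).trans (hC s))), ← Iic_inter_Ioi,
    ← Measure.restrict_restrict measurableSet_Iic, ← lintegral_indicator measurableSet_Iic]
  refine lintegral_congr fun s => ?_
  simp [indicator, ENNReal.ofReal_le_ofReal_iff hT]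

theorem setLIntegral_Ioi_exp_mul_ofReal_sub {f : ℝ → ℝ} (hf : Measurable f) {C : ℝ}
    (hC : ∀ s, |f s| ≤ C) {α : ℝ} (hα : 0 < α) :
    ∫⁻ s in Ioi (0 : ℝ), (if ENNReal.ofReal s < ⊤ then
        ENNReal.ofReal (Real.exp (-α * (ENNReal.ofReal s).toReal)) else 0) *
        ENNReal.ofReal (C - f s) =
      ENNReal.ofReal (C / α - ∫ s in Ioi (0 : ℝ), Real.exp (-α * s) * f s) := by
  have hneg : -α < 0 := neg_lt_zero.mpr hα
  have hie := integrableOn_exp_mul_Ioi hneg 0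
  have hif : IntegrableOn (fun s => Real.exp (-α * s) * f s) (Ioi 0) :=
    hie.mul_bdd hf.aestronglyMeasurable (ae_of_all _ fun s => by simpa using hC s)
  have hi : ∫ s in Ioi (0 : ℝ), (Real.exp (-α * s) * C - Real.exp (-α * s) * f s) =
      C / α - ∫ s in Ioi (0 : ℝ), Real.exp (-α * s) * f s := by
    rw [integral_sub (hie.mul_const C) hif, integral_mul_const, integral_exp_mul_Ioi hneg]
    congr 1
    simp
    field_simp
  rw [← hi, ofReal_integral_eq_lintegral_ofReal
    (f := fun s => Real.exp (-α * s) * C - Real.exp (-α * s) * f s) ((hie.mul_const C).sub hif)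
    (ae_of_all _ fun s => ?_)]
  · refine setLIntegral_congr_fun measurableSet_Ioi fun s hs => ?_
    simp only [ENNReal.ofReal_lt_top, if_true, ENNReal.toReal_ofReal (le_of_lt hs)]
    rw [← ENNReal.ofReal_mul (Real.exp_pos _).le, mul_sub]
  · change 0 ≤ Real.exp (-α * s) * C - Real.exp (-α * s) * f s
    rw [← mul_sub]
    exact mul_nonneg (Real.exp_pos _).le (sub_nonneg.mpr ((le_abs_self _).trans (hC s)))

/-- Tauberian inequality, Lemma `lem:tauber` of the paper.
The expectation `E[Σᵢ 1_{τᵢ ≤ T} Yᵢ]` of the sum of nonpositive random variables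
is encoded, with values in `[−∞, 0]`, as minus the lower integral of the sum of
`1_{τᵢ ≤ T}·(−Yᵢ)`; similarly `E[Σᵢ 1_{τᵢ < ∞} e^{−ατᵢ} Yᵢ]` is encoded as minus
the lower integral of `1_{τᵢ < ∞} e^{−ατᵢ}·(−Yᵢ)` (with `e^{−α·∞} = 0`).
Both sides are elements of the extended reals `EReal`. -/
theorem stmt0 {Ω : Type*} [MeasurableSpace Ω] (P : Measure Ω)
    [IsProbabilityMeasure P]
    (f : ℝ → ℝ) (hf_meas : Measurable f) (C : ℝ) (hf_bdd : ∀ s : ℝ, |f s| ≤ C)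
    (Y : ℕ → Ω → ℝ) (hY_meas : ∀ i, Measurable (Y i))
    (hY_nonpos : ∀ i, ∀ᵐ ω ∂P, Y i ω ≤ 0)
    (τ : ℕ → Ω → ℝ≥0∞) (hτ_meas : ∀ i, Measurable (τ i))
    (hτ_mono : ∀ ω, Monotone fun i => τ i ω) :
    liminf (fun T : ℝ =>
        ((1 / T : ℝ) : EReal) *
          (((∫ s in Set.Ioc (0 : ℝ) T, f s : ℝ) : EReal) -
            ((∫⁻ ω, ∑' i : ℕ, (if τ i ω ≤ ENNReal.ofReal T
                then ENNReal.ofReal (-(Y i ω)) else 0) ∂P : ℝ≥0∞) : EReal)))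
      atTop
    ≤ liminf (fun α : ℝ =>
        ((α : ℝ) : EReal) *
          (((∫ s in Set.Ioi (0 : ℝ), Real.exp (-α * s) * f s : ℝ) : EReal) -
            ((∫⁻ ω, ∑' i : ℕ, (if τ i ω < ⊤
                then ENNReal.ofReal (Real.exp (-α * (τ i ω).toReal) * (-(Y i ω)))
                else 0) ∂P : ℝ≥0∞) : EReal)))
      (𝓝[>] (0 : ℝ)) := by
  set A : ℝ → ℝ≥0∞ := fun T => ∫⁻ ω, ∑' i : ℕ, (if τ i ω ≤ ENNReal.ofReal T
    then ENNReal.ofReal (-(Y i ω)) else 0) ∂P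
  set B : ℝ → ℝ≥0∞ := fun α => ∫⁻ ω, ∑' i : ℕ, (if τ i ω < ⊤
    then ENNReal.ofReal (Real.exp (-α * (τ i ω).toReal) * (-(Y i ω))) else 0) ∂P with hB
  set H : ℝ → ℝ≥0∞ := fun T => ∫⁻ s in Ioi (0 : ℝ),
    (if ENNReal.ofReal s ≤ ENNReal.ofReal T then ENNReal.ofReal (C - f s) else 0)
  have hind : ∀ (t w : ℝ≥0∞) {S T : ℝ}, S ≤ T →
      (if t ≤ ENNReal.ofReal S then w else 0) ≤ (if t ≤ ENNReal.ofReal T then w else 0) := by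
    intro t w S T hST
    by_cases h : t ≤ ENNReal.ofReal S
    · rw [if_pos h, if_pos (h.trans (ENNReal.ofReal_le_ofReal hST))]
    · rw [if_neg h]
      exact zero_le
  have hAmono : Monotone A := fun S T hST =>
    lintegral_mono fun ω => ENNReal.tsum_le_tsum fun i => hind _ _ hST
  have hHmono : Monotone H := fun S T hST => lintegral_mono fun s => hind _ _ hST
  have hBA : ∀ α : ℝ, 0 < α →
      B α = ∫⁻ T in Ioi (0 : ℝ), ENNReal.ofReal (α * Real.exp (-α * T)) * A T := by
    intro α hα
    have hg : Measurable fun T : ℝ => ENNReal.ofReal (α * Real.exp (-α * T)) := by fun_prop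
    have hYm : ∀ i, Measurable fun ω => ENNReal.ofReal (-(Y i ω)) := fun i =>
      (hY_meas i).neg.ennreal_ofReal
    have hm : ∀ (i : ℕ) (T : ℝ), Measurable fun ω =>
        if τ i ω ≤ ENNReal.ofReal T then ENNReal.ofReal (-(Y i ω)) else 0 := fun i T =>
      Measurable.ite (measurableSet_le (hτ_meas i) measurable_const) (hYm i) measurable_const
    have hmono : ∀ i, Monotone fun T : ℝ =>
        ∫⁻ ω, (if τ i ω ≤ ENNReal.ofReal T then ENNReal.ofReal (-(Y i ω)) else 0) ∂P :=
      fun i S T hST => lintegral_mono fun ω => hind _ _ hST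
    have hAsum : ∀ T, A T = ∑' i,
        ∫⁻ ω, (if τ i ω ≤ ENNReal.ofReal T then ENNReal.ofReal (-(Y i ω)) else 0) ∂P :=
      fun T => lintegral_tsum fun i => (hm i T).aemeasurable
    have hterm : ∀ i ω, (if τ i ω < ⊤
        then ENNReal.ofReal (Real.exp (-α * (τ i ω).toReal) * (-(Y i ω))) else 0) =
        (if τ i ω < ⊤ then ENNReal.ofReal (Real.exp (-α * (τ i ω).toReal)) else 0) *
          ENNReal.ofReal (-(Y i ω)) := by
      intro i ω
      split_ifs
      · exact ENNReal.ofReal_mul (Real.exp_pos _).le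
      · simp
    simp_rw [hB, hAsum, hterm, ← ENNReal.tsum_mul_left]
    rw [lintegral_tsum, lintegral_tsum]
    · exact tsum_congr fun i => lintegral_exp_weight_eq P hα (hτ_meas i) (hYm i)
    · exact fun i => (hg.mul (hmono i).measurable).aemeasurable
    · refine fun i => ((Measurable.ite (measurableSet_lt (hτ_meas i) measurable_const) ?_
        measurable_const).mul (hYm i)).aemeasurable
      exact (Real.measurable_exp.comp ((hτ_meas i).ennreal_toReal.const_mul (-α))).ennreal_ofReal
  refine le_of_forall_lt_imp_le_of_dense fun c hc => ?_
  have hev := eventually_lt_of_lt_liminf hc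
  induction c with
  | bot => exact bot_le
  | top => exact absurd hc not_top_lt
  | coe c =>
    obtain ⟨T₁, hT₁⟩ := eventually_atTop.mp hev
    set T₀ := max T₁ 1
    have hlin : ∀ T, T₀ ≤ T → 0 ≤ C - c ∧ H T + A T ≤ ENNReal.ofReal ((C - c) * T) := by
      intro T hT
      have hTpos : 0 < T := zero_lt_one.trans_le ((le_max_right _ _).trans hT)
      have hlt := hT₁ T ((le_max_left _ _).trans hT)
      have hHT : H T = ENNReal.ofReal (C * T - ∫ s in Ioc 0 T, f s) :=
        setLIntegral_Ioi_ofReal_sub_indicator hf_meas hf_bdd hTpos.le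
      have hnn : 0 ≤ C * T - ∫ s in Ioc 0 T, f s := by
        have := norm_setIntegral_le_of_norm_le_const (μ := volume) (s := Ioc 0 T) (f := f) (C := C)
          (by simp) (fun s _ => by simpa using hf_bdd s)
        simp [hTpos.le, measureReal_def] at this
        linarith [le_abs_self (∫ s in Ioc 0 T, f s)]
      change (c : EReal) < ((1 / T : ℝ) : EReal) * (_ - (A T : EReal)) at hlt
      have hAfin : A T ≠ ⊤ := by
        intro htop
        rw [htop, EReal.coe_ennreal_top, EReal.sub_top,
          EReal.coe_mul_bot_of_pos (one_div_pos.mpr hTpos)] at hlt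
        exact not_lt_bot hlt
      rw [← EReal.coe_ennreal_toReal hAfin, ← EReal.coe_sub, ← EReal.coe_mul,
        EReal.coe_lt_coe_iff, one_div_mul_eq_div, lt_div_iff₀ hTpos] at hlt
      have ha : 0 ≤ (A T).toReal := ENNReal.toReal_nonneg
      refine ⟨?_, ?_⟩
      · by_contra! hneg
        nlinarith
      · rw [hHT, ← ENNReal.ofReal_toReal hAfin, ← ENNReal.ofReal_add hnn ha]
        exact ENNReal.ofReal_le_ofReal (by linarith)
    have hL := (hlin T₀ le_rfl).1
    have hNfin : H T₀ + A T₀ ≠ ⊤ := ((hlin T₀ le_rfl).2.trans_lt ENNReal.ofReal_lt_top).ne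
    set M := (H T₀ + A T₀).toReal
    have hlim : Tendsto (fun α : ℝ => ((c - α * M : ℝ) : EReal)) (𝓝[>] 0) (𝓝 (c : EReal)) := by
      refine (continuous_coe_real_ereal.tendsto c).comp ?_
      have : Tendsto (fun α : ℝ => c - α * M) (𝓝 0) (𝓝 (c - 0 * M)) :=
        Continuous.tendsto (by fun_prop) 0
      rw [zero_mul, sub_zero] at this
      exact this.mono_left nhdsWithin_le_nhds
    rw [← hlim.liminf_eq]
    refine liminf_le_liminf ?_
    filter_upwards [self_mem_nhdsWithin] with α (hα : 0 < α)
    have hbound : ENNReal.ofReal (C / α - ∫ s in Ioi (0 : ℝ), Real.exp (-α * s) * f s) + B α ≤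
        ENNReal.ofReal (M + (C - c) / α) := by
      have hg : Measurable fun T : ℝ => ENNReal.ofReal (α * Real.exp (-α * T)) := by fun_prop
      rw [← setLIntegral_Ioi_exp_mul_ofReal_sub hf_meas hf_bdd hα,
        lintegral_exp_weight_eq (volume.restrict (Ioi (0 : ℝ))) hα ENNReal.measurable_ofReal
          (w := fun s => ENNReal.ofReal (C - f s)) (measurable_const.sub hf_meas).ennreal_ofReal, hBA α hα,
        ← lintegral_add_left
          (f := fun T => ENNReal.ofReal (α * Real.exp (-α * T)) * H T)
          (hg.mul hHmono.measurable)]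
      simp_rw [← mul_add]
      rw [ENNReal.ofReal_add ENNReal.toReal_nonneg (by positivity),
        ENNReal.ofReal_toReal hNfin]
      exact setLIntegral_exp_mul_le_of_linear_growth (N := fun T => H T + A T)
        (hHmono.add hAmono) hL (fun T hT => (hlin T hT).2) hα
    have hBfin : B α ≠ ⊤ :=
      ((le_add_self.trans hbound).trans_lt ENNReal.ofReal_lt_top).ne
    have hreal : C / α - (∫ s in Ioi (0 : ℝ), Real.exp (-α * s) * f s) + (B α).toReal ≤
        M + (C - c) / α := by
      have hM0 : 0 ≤ M + (C - c) / α := add_nonneg ENNReal.toReal_nonneg (by positivity)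
      have h1 := ENNReal.toReal_mono ENNReal.ofReal_ne_top hbound
      rw [ENNReal.toReal_add ENNReal.ofReal_ne_top hBfin, ENNReal.toReal_ofReal hM0] at h1
      have h2 := Real.le_coe_toNNReal (C / α - ∫ s in Ioi (0 : ℝ), Real.exp (-α * s) * f s)
      exact (add_le_add_left h2 _).trans h1
    change ((c - α * M : ℝ) : EReal) ≤ (α : EReal) * (_ - (B α : EReal))
    rw [← EReal.coe_ennreal_toReal hBfin, ← EReal.coe_sub, ← EReal.coe_mul,
      EReal.coe_le_coe_iff]
    have h3 := mul_le_mul_of_nonneg_left hreal hα.le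
    have h4 : α * (C / α) = C := by field_simp
    have h5 : α * ((C - c) / α) = C - c := by field_simp
    rw [mul_add, mul_sub, mul_add, h4, h5] at h3
    rw [mul_sub]
    linarith
end

section
/- For every compact set Γ ⊆ E and every ε > 0 there exists δ > 0 such that for all x, x′ ∈ Γ with ρ(x, x′) < δ and every function w : E → ℝ that is bounded on U, |Mw(x) − Mw(x′)| ≤ ε. In other words, the family of functions x ↦ Mw(x), indexed by all functions w : E → ℝ bounded on U, is uniformly equicontinuous on each compact subset of E. -/
open Metric Set

/-- The impulse operator `Mw(x) = sup_{ξ ∈ U} (c(x,ξ) + w(ξ))`. -/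
noncomputable def Mop {E : Type*} [MetricSpace E] (U : Set E) (c : E × E → ℝ)
    (w : E → ℝ) (x : E) : ℝ :=
  sSup ((fun ξ => c (x, ξ) + w ξ) '' U)

theorem Mop_le_add {E : Type*} [MetricSpace E] {U : Set E} (hU : IsCompact U)
    (hUne : U.Nonempty) {c : E × E → ℝ} (hc : Continuous c) {w : E → ℝ} {C : ℝ}
    (hw : ∀ ξ ∈ U, w ξ ≤ C) {x x' : E} {ε : ℝ}
    (h : ∀ ξ ∈ U, c (x, ξ) ≤ c (x', ξ) + ε) :
    Mop U c w x ≤ Mop U c w x' + ε := by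
  obtain ⟨B, hB⟩ := hU.bddAbove_image (f := fun ξ => c (x', ξ)) (by fun_prop)
  have hbdd : BddAbove ((fun ξ => c (x', ξ) + w ξ) '' U) := by
    refine ⟨B + C, ?_⟩
    rintro _ ⟨ξ, hξ, rfl⟩
    exact add_le_add (hB (mem_image_of_mem _ hξ)) (hw ξ hξ)
  refine csSup_le (hUne.image _) ?_
  rintro _ ⟨ξ, hξ, rfl⟩
  have hle : c (x', ξ) + w ξ ≤ Mop U c w x' := le_csSup hbdd (mem_image_of_mem _ hξ)
  linarith [h ξ hξ]

/-- the family `x ↦ Mw(x)`, indexed by all functions `w` bounded on `U`,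
is uniformly equicontinuous on each compact subset of `E`. -/
theorem stmt3 {E : Type*} [MetricSpace E] (U : Set E) (hU : IsCompact U)
    (hUne : U.Nonempty) (c : E × E → ℝ) (hc : Continuous c) :
    ∀ Γ : Set E, IsCompact Γ → ∀ ε : ℝ, 0 < ε → ∃ δ : ℝ, 0 < δ ∧
      ∀ x ∈ Γ, ∀ x' ∈ Γ, dist x x' < δ →
        ∀ w : E → ℝ, (∃ C : ℝ, ∀ ξ ∈ U, |w ξ| ≤ C) →
          |Mop U c w x - Mop U c w x'| ≤ ε := by
  intro Γ hΓ ε hε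
  obtain ⟨δ, hδ, hcδ⟩ := Metric.uniformContinuousOn_iff.1
    ((hΓ.prod hU).uniformContinuousOn_of_continuous hc.continuousOn) ε hε
  refine ⟨δ, hδ, fun x hx x' hx' hxx' w ⟨C, hC⟩ => ?_⟩
  have hcε : ∀ ξ ∈ U, |c (x, ξ) - c (x', ξ)| < ε := fun ξ hξ =>
    hcδ (x, ξ) ⟨hx, hξ⟩ (x', ξ) ⟨hx', hξ⟩ (by simpa [Prod.dist_eq, hδ] using hxx')
  have hw : ∀ ξ ∈ U, w ξ ≤ C := fun ξ hξ => (le_abs_self _).trans (hC ξ hξ)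
  have hxle : Mop U c w x ≤ Mop U c w x' + ε := Mop_le_add hU hUne hc hw fun ξ hξ => by
    linarith [(abs_lt.1 (hcε ξ hξ)).2]
  have hxle' : Mop U c w x' ≤ Mop U c w x + ε := Mop_le_add hU hUne hc hw fun ξ hξ => by
    linarith [(abs_lt.1 (hcε ξ hξ)).1]
  exact abs_sub_le_iff.2 ⟨by linarith, by linarith⟩
end

section
/- Let E be a locally compact separable metric space and let κ be a Markov kernel from E to E such that for every continuous function f : E → ℝ vanishing at infinity, the map x ↦ ∫ f(y) κ(x)(dy) is continuous and vanishes at infinity. Then for every continuous function φ : E → ℝ that is bounded from above and is integrable with respect to κ(x) for every x ∈ E, the map x ↦ ∫ φ(y) κ(x)(dy) is upper semicontinuous and bounded from above (by sup_{y∈E} φ(y)). -/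
open MeasureTheory Filter Set ProbabilityTheory

/-- On a locally compact separable metric space there is a sequence of continuous compactly
supported cutoff functions with values in `[0, 1]`, each point having value eventually `1`. -/
lemma exists_cutoff_seq (E : Type*) [MetricSpace E] [LocallyCompactSpace E]
    [TopologicalSpace.SeparableSpace E] :
    ∃ h : ℕ → E → ℝ, (∀ n, Continuous (h n)) ∧ (∀ n, HasCompactSupport (h n)) ∧
      (∀ n x, h n x ∈ Icc (0 : ℝ) 1) ∧ ∀ x, ∀ᶠ n in atTop, h n x = 1 := by
  have : SecondCountableTopology E := UniformSpace.secondCountable_of_separable E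
  let K : CompactExhaustion E := default
  have hK : ∀ n, ∃ f : C(E, ℝ), EqOn f 1 (K n) ∧ HasCompactSupport f ∧
      ∀ x, f x ∈ Icc (0 : ℝ) 1 := fun n => by
    obtain ⟨f, h1, -, h2, h3⟩ :=
      exists_continuous_one_zero_of_isCompact (K.isCompact n) isClosed_empty (disjoint_empty _)
    exact ⟨f, h1, h2, h3⟩
  choose f h1 h2 h3 using hK
  refine ⟨fun n => f n, fun n => (f n).continuous, h2, h3, fun x => ?_⟩
  obtain ⟨m, hm⟩ := K.exists_mem x
  filter_upwards [eventually_ge_atTop m] with n hn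
  exact h1 n (K.subset hn hm)

/-- If a Markov kernel integrates continuous compactly supported functions to continuous functions,
then it integrates nonnegative continuous functions to lower semicontinuous functions. -/
lemma lowerSemicontinuous_integral_of_nonneg {E : Type*} [MetricSpace E] [LocallyCompactSpace E]
    [TopologicalSpace.SeparableSpace E] [MeasurableSpace E] [BorelSpace E] (κ : Kernel E E)
    (hκ : ∀ f : E → ℝ, Continuous f → HasCompactSupport f →
      Continuous (fun x => ∫ y, f y ∂(κ x)))
    (g : E → ℝ) (hg : Continuous g) (hg0 : ∀ y, 0 ≤ g y) (hgi : ∀ x, Integrable g (κ x)) :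
    LowerSemicontinuous (fun x => ∫ y, g y ∂(κ x)) := by
  have : SecondCountableTopology E := UniformSpace.secondCountable_of_separable E
  obtain ⟨h, hc, hs, hI, h1⟩ := exists_cutoff_seq E
  have hle : ∀ n y, h n y * g y ≤ g y := fun n y =>
    mul_le_of_le_one_left (hg0 y) (hI n y).2
  have hnn : ∀ n y, 0 ≤ h n y * g y := fun n y => mul_nonneg (hI n y).1 (hg0 y)
  have hmeas : ∀ n x, AEStronglyMeasurable (fun y => h n y * g y) (κ x) := fun n x =>
    ((hc n).mul hg).aestronglyMeasurable
  have hb : ∀ n y, ‖h n y * g y‖ ≤ g y := fun n y => by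
    rw [Real.norm_of_nonneg (hnn n y)]
    exact hle n y
  intro x a ha
  have hlim : Tendsto (fun n => ∫ y, h n y * g y ∂(κ x)) atTop (nhds (∫ y, g y ∂(κ x))) := by
    refine tendsto_integral_of_dominated_convergence g (fun n => hmeas n x) (hgi x)
      (fun n => ae_of_all _ (hb n)) (ae_of_all _ fun y => ?_)
    refine tendsto_const_nhds.congr' ?_
    filter_upwards [h1 y] with n hn
    rw [hn, one_mul]
  obtain ⟨n, hn⟩ := (hlim.eventually_const_lt ha).exists
  have hcont := hκ _ ((hc n).mul hg) ((hs n).mul_right (f' := g))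
  filter_upwards [hcont.continuousAt.eventually_const_lt hn] with z hz
  exact hz.trans_le <| integral_mono ((hgi z).mono' (hmeas n z) (ae_of_all _ (hb n))) (hgi z) (hle n)

/-- a weakly Feller Markov kernel maps continuous functions that are
bounded from above (and integrable) into upper semicontinuous functions bounded
from above by `sup φ`. -/
theorem stmt7 {E : Type*} [MetricSpace E] [LocallyCompactSpace E]
    [TopologicalSpace.SeparableSpace E] [MeasurableSpace E] [BorelSpace E]
    (κ : Kernel E E) [IsMarkovKernel κ]
    (hFeller : ∀ f : E → ℝ, Continuous f → Tendsto f (cocompact E) (nhds 0) →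
      Continuous (fun x => ∫ y, f y ∂(κ x)) ∧
        Tendsto (fun x => ∫ y, f y ∂(κ x)) (cocompact E) (nhds 0))
    (φ : E → ℝ) (hφ_cont : Continuous φ) (hφ_bdd : BddAbove (Set.range φ))
    (hφ_int : ∀ x : E, Integrable φ (κ x)) :
    UpperSemicontinuous (fun x => ∫ y, φ y ∂(κ x)) ∧
      ∀ x : E, (∫ y, φ y ∂(κ x)) ≤ sSup (Set.range φ) := by
  have hle : ∀ y, φ y ≤ sSup (range φ) := fun y => le_csSup hφ_bdd (mem_range_self y)
  have hsub : ∀ x, ∫ y, (sSup (range φ) - φ y) ∂(κ x) = sSup (range φ) - ∫ y, φ y ∂(κ x) :=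
    fun x => by
      rw [integral_sub (integrable_const _) (hφ_int x)]
      simp
  refine ⟨fun x a ha => ?_, fun x => ?_⟩
  · have hlsc := lowerSemicontinuous_integral_of_nonneg κ
      (fun f hf hfs => (hFeller f hf hfs.is_zero_at_infty).1) (fun y => sSup (range φ) - φ y)
      (continuous_const.sub hφ_cont) (fun y => sub_nonneg.2 (hle y))
      (fun x => (integrable_const _).sub (hφ_int x))
    simp only [hsub] at hlsc
    filter_upwards [hlsc x (sSup (range φ) - a) (sub_lt_sub_left ha _)] with z hz
    exact (sub_lt_sub_iff_left _).1 hz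
  · rw [← sub_nonneg, ← hsub x]
    exact integral_nonneg fun y => sub_nonneg.2 (hle y)
end

section
/- If in addition ∫ f dμ < η, then for all sufficiently large integers N, the set {x ∈ E : f_N(x) ≤ ∫ f_N dμ} is contained in the ball B_{z,N+1}. -/
open Metric Set MeasureTheory

/-- The truncated function
`f_N(x) = f(x)(1 − ρ(x, B_{z,N}))⁺ + η(1 − ρ(x, B_{z,N+1}ᶜ))⁺`. -/
noncomputable def fTrunc {E : Type*} [MetricSpace E] (f : E → ℝ) (η : ℝ) (z : E)
    (N : ℕ) (x : E) : ℝ :=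
  f x * max (1 - Metric.infDist x (Metric.ball z (N : ℝ))) 0 +
    η * max (1 - Metric.infDist x ((Metric.ball z ((N : ℝ) + 1))ᶜ)) 0

open Filter Topology

theorem continuous_fTrunc {E : Type*} [MetricSpace E] {f : E → ℝ} (hf : Continuous f)
    (η : ℝ) (z : E) (N : ℕ) : Continuous (fTrunc f η z N) := by
  unfold fTrunc
  have h1 := Metric.continuous_infDist_pt (Metric.ball z (N : ℝ))
  have h2 := Metric.continuous_infDist_pt (Metric.ball z ((N : ℝ) + 1))ᶜ
  fun_prop

theorem fTrunc_nonneg {E : Type*} [MetricSpace E] {f : E → ℝ} (hf : ∀ x, 0 ≤ f x)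
    {η : ℝ} (hη : 0 ≤ η) (z : E) (N : ℕ) (x : E) : 0 ≤ fTrunc f η z N x :=
  add_nonneg (mul_nonneg (hf x) (le_max_right _ _)) (mul_nonneg hη (le_max_right _ _))

theorem fTrunc_le_add {E : Type*} [MetricSpace E] {f : E → ℝ} (hf : ∀ x, 0 ≤ f x)
    {η : ℝ} (hη : 0 ≤ η) (z : E) (N : ℕ) (x : E) : fTrunc f η z N x ≤ f x + η := by
  have cutoff_le_one (s : Set E) : max (1 - Metric.infDist x s) 0 ≤ 1 :=
    max_le (sub_le_self _ Metric.infDist_nonneg) zero_le_one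
  exact add_le_add (mul_le_of_le_one_right (hf x) (cutoff_le_one _))
    (mul_le_of_le_one_right hη (cutoff_le_one _))

/-- Inside `B_{z,N}` the truncation does not change `f`. -/
theorem fTrunc_eq_of_mem_ball {E : Type*} [MetricSpace E] (f : E → ℝ) (η : ℝ) {z x : E} {N : ℕ}
    (hne : ((Metric.ball z ((N : ℝ) + 1))ᶜ).Nonempty) (hx : x ∈ Metric.ball z (N : ℝ)) :
    fTrunc f η z N x = f x := by
  have hfar : 1 ≤ Metric.infDist x (Metric.ball z ((N : ℝ) + 1))ᶜ := by
    refine (Metric.le_infDist hne).2 fun y hy => ?_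
    rw [Set.mem_compl_iff, Metric.mem_ball, not_lt] at hy
    rw [Metric.mem_ball] at hx
    linarith [dist_triangle_left y z x]
  simp [fTrunc, Metric.infDist_zero_of_mem hx, max_eq_right (sub_nonpos.2 hfar)]

theorem le_fTrunc_of_notMem_ball {E : Type*} [MetricSpace E] {f : E → ℝ} (hf : ∀ x, 0 ≤ f x)
    (η : ℝ) {z x : E} {N : ℕ} (hx : x ∉ Metric.ball z ((N : ℝ) + 1)) :
    η ≤ fTrunc f η z N x := by
  have h := mul_nonneg (hf x) (le_max_right (1 - Metric.infDist x (Metric.ball z (N : ℝ))) 0)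
  simpa [fTrunc, Metric.infDist_zero_of_mem (Set.mem_compl hx)] using h

theorem tendsto_integral_fTrunc {E : Type*} [MetricSpace E] [MeasurableSpace E] [BorelSpace E]
    {z : E} (hne : ∀ N : ℕ, 1 ≤ N → ((Metric.ball z ((N : ℝ) + 1))ᶜ).Nonempty)
    {μ : Measure E} [IsFiniteMeasure μ] {f : E → ℝ} (hf_cont : Continuous f)
    (hf_nonneg : ∀ x, 0 ≤ f x) (hf_int : Integrable f μ) {η : ℝ} (hη : 0 ≤ η) :
    Tendsto (fun N : ℕ => ∫ x, fTrunc f η z N x ∂μ) atTop (𝓝 (∫ x, f x ∂μ)) := by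
  refine tendsto_integral_of_dominated_convergence (fun x => f x + η)
    (fun N => (continuous_fTrunc hf_cont η z N).measurable.aestronglyMeasurable)
    (hf_int.add (integrable_const η)) (fun N => .of_forall fun x => ?_) (.of_forall fun x => ?_)
  · rw [Real.norm_of_nonneg (fTrunc_nonneg hf_nonneg hη z N x)]
    exact fTrunc_le_add hf_nonneg hη z N x
  · refine tendsto_const_nhds.congr' ?_
    filter_upwards [eventually_ge_atTop 1,
      tendsto_natCast_atTop_atTop.eventually_gt_atTop (dist x z)] with N hN hxN
    exact (fTrunc_eq_of_mem_ball f η (hne N hN) hxN).symm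

/-- if `∫ f dμ < η`, then for all sufficiently large `N` the set
`{x : f_N(x) ≤ μ(f_N)}` is contained in the ball `B_{z,N+1}`. -/
theorem stmt12 {E : Type*} [MetricSpace E] [MeasurableSpace E] [BorelSpace E]
    (z : E) (hne : ∀ N : ℕ, 1 ≤ N → ((Metric.ball z ((N : ℝ) + 1))ᶜ).Nonempty)
    (μ : Measure E) [IsProbabilityMeasure μ]
    (f : E → ℝ) (hf_cont : Continuous f) (hf_nonneg : ∀ x, 0 ≤ f x)
    (hf_bdd : BddAbove (Set.range f))
    (η : ℝ) (hη0 : 0 ≤ η) (hη1 : η ≤ sSup (Set.range f))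
    (hη2 : (∫ x, f x ∂μ) < η) :
    ∃ N₀ : ℕ, ∀ N : ℕ, N₀ ≤ N →
      {x : E | fTrunc f η z N x ≤ ∫ y, fTrunc f η z N y ∂μ} ⊆
        Metric.ball z ((N : ℝ) + 1) := by
  obtain ⟨C, hC⟩ := hf_bdd
  have hf_int : Integrable f μ :=
    .of_bound hf_cont.measurable.aestronglyMeasurable C <| .of_forall fun x => by
      rw [Real.norm_of_nonneg (hf_nonneg x)]
      exact hC (Set.mem_range_self x)
  obtain ⟨N₀, hN₀⟩ := eventually_atTop.1
    ((tendsto_integral_fTrunc hne hf_cont hf_nonneg hf_int hη0).eventually_lt_const hη2)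
  refine ⟨N₀, fun N hN x hx => ?_⟩
  by_contra hxball
  exact ((le_fTrunc_of_notMem_ball hf_nonneg η hxball).trans hx).not_gt (hN₀ N hN)
end
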